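/- Let Υ be a path connection on G satisfying the reparametrization law, and let 𝒰 be an open cover of X. Then C_Υ(G) is generated by the family C_{Υ|U}(G|U), U ∈ 𝒰; that is, C_Υ(G) is the smallest subgroupoid of G containing C_{Υ|U}(G|U) for every U ∈ 𝒰. -/

import Mathlib

/-!
STATEMENT 4: given an open cover `𝒰` of `X`, `C_Υ(G)` is the smallest subgroupoid of `G`
containing `C_{Υ|U}(G|U)` for every `U ∈ 𝒰`.
-/

open CategoryTheory

noncomputable section

/-- A (smooth) diffeomorphism `ψ : [0,1] → [t₀,t₁] ⊆ [0,1]`, orientation preserving or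
reversing: a smooth real function mapping `[0,1]` bijectively onto `[t₀,t₁]` with nowhere
vanishing derivative on `[0,1]`. -/
structure IntervalDiffeo (t₀ t₁ : unitInterval) : Type where
  toFun : ℝ → ℝ
  smooth : ContDiff ℝ (⊤ : ℕ∞) toFun
  bijOn : Set.BijOn toFun (Set.Icc (0 : ℝ) 1) (Set.Icc (t₀ : ℝ) (t₁ : ℝ))
  deriv_ne : ∀ t ∈ Set.Icc (0 : ℝ) 1, deriv toFun t ≠ 0

/-- `ψ`, viewed as a map `[0,1] → [0,1]`. -/
def IntervalDiffeo.restrict {t₀ t₁ : unitInterval} (ψ : IntervalDiffeo t₀ t₁)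
    (t : unitInterval) : unitInterval :=
  ⟨ψ.toFun t, le_trans t₀.2.1 (ψ.bijOn.mapsTo t.2).1, le_trans (ψ.bijOn.mapsTo t.2).2 t₁.2.2⟩

/-- The reparametrized path `λ ∘ ψ`. -/
def IntervalDiffeo.reparam {X : Type*} [TopologicalSpace X] {t₀ t₁ : unitInterval}
    (ψ : IntervalDiffeo t₀ t₁) (lam : C(unitInterval, X)) : C(unitInterval, X) :=
  ⟨fun t => lam (ψ.restrict t),
    lam.continuous.comp ((ψ.smooth.continuous.comp continuous_subtype_val).subtype_mk _)⟩

/-- A path connection on a groupoid `G` with object space `X`: it assigns to each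
(continuous) path `λ` in `X` and each `t ∈ [0,1]` a morphism `Υ^λ(t) : λ(0) ⟶ λ(t)`. -/
def PathConnection (X : Type*) [TopologicalSpace X] [Groupoid X] :=
  ∀ (lam : C(unitInterval, X)) (t : unitInterval), lam 0 ⟶ lam t

/-- The reparametrization law: for every path `λ`, all `0 ≤ t₀ < t₁ ≤ 1` and every
diffeomorphism `ψ : [0,1] → [t₀,t₁]`, one has `Υ^λ(ψ(t)) = Υ^{λ∘ψ}(t) ∘ Υ^λ(ψ(0))`
(where, following the convention `h·g : x ⟶ z` for `g : x ⟶ y`, `h : y ⟶ z`, the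
right-hand side is `Υ^λ(ψ(0)) ≫ Υ^{λ∘ψ}(t)` in categorical notation). -/
def ReparamLaw {X : Type*} [TopologicalSpace X] [Groupoid X] (Υ : PathConnection X) : Prop :=
  ∀ (lam : C(unitInterval, X)) (t₀ t₁ : unitInterval), t₀ < t₁ →
    ∀ (ψ : IntervalDiffeo t₀ t₁) (t : unitInterval),
      Υ lam (ψ.restrict t) = Υ lam (ψ.restrict 0) ≫ Υ (ψ.reparam lam) t

def CUps {X : Type*} [TopologicalSpace X] [Groupoid X] (Υ : PathConnection X) (x y : X) :
    Set (x ⟶ y) :=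
  {g | ∃ (lam : C(unitInterval, X)) (h0 : lam 0 = x) (h1 : lam 1 = y),
      g = eqToHom h0.symm ≫ Υ lam 1 ≫ eqToHom h1}

/-- `C_{Υ|U}(G|U) x y`: the set of morphisms `g : x ⟶ y` of the form `g = Υ^λ(1)` for some
path `λ` from `x` to `y` whose image is contained in `U` (so that `λ` is a path in the full
subgroupoid `G|U` and `Υ^λ = (Υ|U)^λ`). -/
def CUpsOn {X : Type*} [TopologicalSpace X] [Groupoid X] (Υ : PathConnection X) (U : Set X)
    (x y : X) : Set (x ⟶ y) :=
  {g | ∃ lam : C(unitInterval, X), (∀ t, lam t ∈ U) ∧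
      ∃ (h0 : lam 0 = x) (h1 : lam 1 = y), g = eqToHom h0.symm ≫ Υ lam 1 ≫ eqToHom h1}

/-- The affine diffeomorphism of `[0,1]` onto the interval with endpoints `p` and `q`, sending
`0` to `p` and `1` to `q`. -/
def IntervalDiffeo.affine (p q : unitInterval) (h : p ≠ q) : IntervalDiffeo (p ⊓ q) (p ⊔ q) where
  toFun s := p + s * (q - p)
  smooth := by fun_prop
  bijOn := by
    have hne : (q : ℝ) - p ≠ 0 := fun h' => h (Subtype.ext (by linarith))
    refine ⟨fun s hs => ?_, fun s _ t _ hst => ?_, fun u hu => ?_⟩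
    · obtain ⟨h0, h1⟩ := hs
      rcases le_total p q with hpq | hpq
      · have hpq' : (p : ℝ) ≤ q := hpq
        rw [inf_eq_left.2 hpq, sup_eq_right.2 hpq]
        constructor <;> nlinarith
      · have hpq' : (q : ℝ) ≤ p := hpq
        rw [inf_eq_right.2 hpq, sup_eq_left.2 hpq]
        constructor <;> nlinarith
    · exact mul_right_cancel₀ hne (add_left_cancel hst)
    · refine ⟨(u - p) / (q - p), ?_, by field_simp; ring⟩
      rcases le_total p q with hpq | hpq
      · have hpq' : (p : ℝ) ≤ q := hpq
        rw [inf_eq_left.2 hpq, sup_eq_right.2 hpq] at hu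
        have hpos : (0 : ℝ) < q - p := lt_of_le_of_ne (by linarith) hne.symm
        exact ⟨div_nonneg (by linarith [hu.1]) hpos.le,
          (div_le_one hpos).2 (by linarith [hu.2])⟩
      · have hpq' : (q : ℝ) ≤ p := hpq
        rw [inf_eq_right.2 hpq, sup_eq_left.2 hpq] at hu
        have hneg : (q : ℝ) - p < 0 := lt_of_le_of_ne (by linarith) hne
        exact ⟨div_nonneg_of_nonpos (by linarith [hu.2]) hneg.le,
          (div_le_one_of_neg hneg).2 (by linarith [hu.1])⟩
  deriv_ne t _ := by
    have hd : HasDerivAt (fun s : ℝ => (p : ℝ) + s * (q - p)) (1 * ((q : ℝ) - p)) t :=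
      ((hasDerivAt_id t).mul_const _).const_add _
    rw [hd.deriv, one_mul]
    exact fun h' => h (Subtype.ext (by linarith))

lemma IntervalDiffeo.coe_affine_restrict (p q : unitInterval) (h : p ≠ q) (t : unitInterval) :
    (((affine p q h).restrict t : unitInterval) : ℝ) = p + t * (q - p) := rfl

lemma IntervalDiffeo.affine_restrict_zero (p q : unitInterval) (h : p ≠ q) :
    (affine p q h).restrict 0 = p :=
  Subtype.ext (by simp [coe_affine_restrict])

lemma IntervalDiffeo.affine_restrict_one (p q : unitInterval) (h : p ≠ q) :
    (affine p q h).restrict 1 = q :=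
  Subtype.ext (by simp [coe_affine_restrict])

lemma IntervalDiffeo.affine_restrict_mem (p q : unitInterval) (h : p ≠ q) (t : unitInterval) :
    (affine p q h).restrict t ∈ Set.Icc (p ⊓ q) (p ⊔ q) :=
  (affine p q h).bijOn.mapsTo t.2

lemma CategoryTheory.Subgroupoid.eqToHom_comp_comp_eqToHom_mem_iff {X : Type*} [Groupoid X]
    (S : Subgroupoid X) {a b x y : X} (h0 : x = a) (h1 : b = y) (g : a ⟶ b) :
    eqToHom h0 ≫ g ≫ eqToHom h1 ∈ S.arrows x y ↔ g ∈ S.arrows a b := by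
  subst h0 h1
  simp

section PathConnection

variable {X : Type*} [TopologicalSpace X] [Groupoid X] {Υ : PathConnection X}

lemma ReparamLaw.eq_comp_of_restrict_eq (hΥ : ReparamLaw Υ) {t₀ t₁ : unitInterval} (h : t₀ < t₁)
    (ψ : IntervalDiffeo t₀ t₁) {lam μ : C(unitInterval, X)} (hμ : ψ.reparam lam = μ)
    {a b : unitInterval} (t : unitInterval) (ha : ψ.restrict 0 = a) (hb : ψ.restrict t = b)
    (h0 : lam a = μ 0) (h1 : μ t = lam b) :
    Υ lam b = Υ lam a ≫ eqToHom h0 ≫ Υ μ t ≫ eqToHom h1 := by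
  subst hμ ha hb
  have := hΥ lam t₀ t₁ h ψ t
  erw [eqToHom_refl, eqToHom_refl, Category.id_comp, Category.comp_id]
  exact this

lemma ReparamLaw.eq_comp_affine (hΥ : ReparamLaw Υ) {p q : unitInterval} (h : p ≠ q)
    {lam μ : C(unitInterval, X)}
    (hμ : ∀ t, lam ((IntervalDiffeo.affine p q h).restrict t) = μ t)
    (h0 : lam p = μ 0) (h1 : μ 1 = lam q) :
    Υ lam q = Υ lam p ≫ eqToHom h0 ≫ Υ μ 1 ≫ eqToHom h1 :=
  hΥ.eq_comp_of_restrict_eq (inf_lt_sup.2 h) _ (ContinuousMap.ext hμ) 1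
    (IntervalDiffeo.affine_restrict_zero p q h) (IntervalDiffeo.affine_restrict_one p q h) h0 h1

lemma ReparamLaw.apply_zero (hΥ : ReparamLaw Υ) (lam : C(unitInterval, X)) :
    Υ lam 0 = 𝟙 (lam 0) := by
  have h := hΥ.eq_comp_of_restrict_eq (lam := lam) (μ := lam) (inf_lt_sup.2 zero_ne_one)
    (IntervalDiffeo.affine 0 1 zero_ne_one)
    (ContinuousMap.ext fun t => congrArg lam (Subtype.ext
      (by simp [IntervalDiffeo.coe_affine_restrict]))) 0
    (IntervalDiffeo.affine_restrict_zero _ _ _) (IntervalDiffeo.affine_restrict_zero _ _ _) rfl rfl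
  simp only [eqToHom_refl, Category.id_comp, Category.comp_id] at h
  exact ((cancel_epi (Υ lam 0)).1 (by rw [Category.comp_id]; exact h)).symm

lemma CUps_inv_mem (hΥ : ReparamLaw Υ) {x y : X} {g : x ⟶ y} (hg : g ∈ CUps Υ x y) :
    Groupoid.inv g ∈ CUps Υ y x := by
  obtain ⟨lam, rfl, rfl, rfl⟩ := hg
  let p : Path (lam 0) (lam 1) := ⟨lam, rfl, rfl⟩
  let μ : C(unitInterval, X) := p.symm.toContinuousMap
  have h0 : μ 0 = lam 1 := p.symm.source
  have h1 : μ 1 = lam 0 := p.symm.target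
  refine ⟨μ, h0, h1, ?_⟩
  have h := hΥ.eq_comp_affine (lam := lam) (μ := μ) one_ne_zero
    (fun t => congrArg lam (Subtype.ext (by
      simp [IntervalDiffeo.coe_affine_restrict, sub_eq_add_neg]))) h0.symm h1
  rw [hΥ.apply_zero] at h
  rw [← cancel_epi (Υ lam 1), ← h]
  simp

lemma CUps_comp_mem (hΥ : ReparamLaw Υ) {x y z : X} {g : x ⟶ y} (hg : g ∈ CUps Υ x y)
    {k : y ⟶ z} (hk : k ∈ CUps Υ y z) : g ≫ k ∈ CUps Υ x z := by
  obtain ⟨lam, hx, hy, rfl⟩ := hg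
  obtain ⟨μ, hy', hz, rfl⟩ := hk
  let p : Path x y := ⟨lam, hx, hy⟩
  let q : Path y z := ⟨μ, hy', hz⟩
  let ν : C(unitInterval, X) := (p.trans q).toContinuousMap
  let c : unitInterval := ⟨1 / 2, by norm_num, by norm_num⟩
  have hc0 : (0 : unitInterval) ≠ c := fun h => by
    have := congrArg Subtype.val h
    norm_num [c] at this
  have hc1 : c ≠ (1 : unitInterval) := fun h => by
    have := congrArg Subtype.val h
    norm_num [c] at this
  have hleft : ∀ t, ν ((IntervalDiffeo.affine 0 c hc0).restrict t) = lam t := fun t => by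
    change (p.trans q) _ = p t
    have ht := t.2.2
    rw [Path.trans_apply, dif_pos (by
      rw [IntervalDiffeo.coe_affine_restrict]; simp only [c, Set.Icc.coe_zero]; linarith)]
    exact congrArg p (Subtype.ext (by
      simp only [IntervalDiffeo.coe_affine_restrict, c, Set.Icc.coe_zero]; ring))
  have hright : ∀ t, ν ((IntervalDiffeo.affine c 1 hc1).restrict t) = μ t := fun t => by
    change (p.trans q) _ = q t
    have ht := t.2.1
    rw [Path.trans_apply]
    split_ifs with h
    · have ht0 : t = 0 := Subtype.ext (by
        rw [IntervalDiffeo.coe_affine_restrict] at h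
        simp only [c, Set.Icc.coe_one] at h
        simp only [Set.Icc.coe_zero]
        linarith)
      subst ht0
      rw [q.source]
      refine Eq.trans (congrArg p (Subtype.ext ?_)) p.target
      simp [IntervalDiffeo.coe_affine_restrict, c]
    · exact congrArg q (Subtype.ext (by
        simp only [IntervalDiffeo.coe_affine_restrict, c, Set.Icc.coe_one]; ring))
  have hν0 : ν 0 = x := (p.trans q).source
  have hν1 : ν 1 = z := (p.trans q).target
  have hνc : ν c = y := by
    have := hleft 1
    rw [IntervalDiffeo.affine_restrict_one] at this
    exact this.trans hy
  refine ⟨ν, hν0, hν1, ?_⟩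
  rw [hΥ.eq_comp_affine hc1 hright (hνc.trans hy'.symm) (hz.trans hν1.symm),
    hΥ.eq_comp_affine hc0 hleft (hν0.trans hx.symm) (hy.trans hνc.symm), hΥ.apply_zero]
  simp

lemma CategoryTheory.Subgroupoid.pathConnection_mem_of_cover (hΥ : ReparamLaw Υ) {𝒰 : Set (Set X)}
    (hopen : ∀ U ∈ 𝒰, IsOpen U) (hcover : ∀ x : X, ∃ U ∈ 𝒰, x ∈ U) (S : Subgroupoid X)
    (hS : ∀ U ∈ 𝒰, ∀ x y : X, CUpsOn Υ U x y ⊆ S.arrows x y) (lam : C(unitInterval, X)) :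
    Υ lam 1 ∈ S.arrows (lam 0) (lam 1) := by
  obtain ⟨t, ht0, htm, ⟨n, hn⟩, ht⟩ := exists_monotone_Icc_subset_open_cover_unitInterval
    (c := fun U : 𝒰 => lam ⁻¹' U) (fun U => (hopen U U.2).preimage lam.continuous)
    (fun s _ => by
      obtain ⟨U, hU, hs⟩ := hcover (lam s)
      exact Set.mem_iUnion.2 ⟨⟨U, hU⟩, hs⟩)
  have key : ∀ m, Υ lam (t m) ∈ S.arrows (lam 0) (lam (t m)) := by
    intro m
    induction m with
    | zero =>
      rw [ht0, hΥ.apply_zero]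
      obtain ⟨U, hU, h0⟩ := hcover (lam 0)
      have hconst := hS U hU (lam 0) (lam 0)
        ⟨ContinuousMap.const _ (lam 0), fun _ => h0, rfl, rfl, rfl⟩
      simpa using S.mul hconst (S.inv hconst)
    | succ m ih =>
      by_cases h : t m = t (m + 1)
      · rwa [← h]
      · let ψ := IntervalDiffeo.affine _ _ h
        have h0 : ψ.reparam lam 0 = lam (t m) :=
          congrArg lam (IntervalDiffeo.affine_restrict_zero _ _ h)
        have h1 : ψ.reparam lam 1 = lam (t (m + 1)) :=
          congrArg lam (IntervalDiffeo.affine_restrict_one _ _ h)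
        rw [hΥ.eq_comp_affine h (μ := ψ.reparam lam) (fun _ => rfl) h0.symm h1]
        obtain ⟨U, hU⟩ := ht m
        refine S.mul ih (hS U U.2 _ _ ⟨ψ.reparam lam, fun s => hU ?_, h0, h1, rfl⟩)
        have hs := IntervalDiffeo.affine_restrict_mem _ _ h s
        exact ⟨(le_inf le_rfl (htm m.le_succ)).trans hs.1, hs.2.trans (sup_le (htm m.le_succ) le_rfl)⟩
  have := key n
  rwa [hn n le_rfl] at this

end PathConnection

/-- For an open cover `𝒰` of `X`, the wide subgroupoid `C_Υ(G)` is the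
smallest subgroupoid of `G` containing `C_{Υ|U}(G|U)` for every `U ∈ 𝒰`: it is a
subgroupoid, it contains each `C_{Υ|U}(G|U)`, and it is contained in every subgroupoid
containing all the `C_{Υ|U}(G|U)`. -/
theorem CUps_generated {X : Type*} [TopologicalSpace X] [Groupoid X]
    (Υ : PathConnection X) (hΥ : ReparamLaw Υ)
    (𝒰 : Set (Set X)) (hopen : ∀ U ∈ 𝒰, IsOpen U) (hcover : ∀ x : X, ∃ U ∈ 𝒰, x ∈ U) :
    (∃ S₀ : Subgroupoid X, ∀ x y : X, S₀.arrows x y = CUps Υ x y) ∧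
    (∀ U ∈ 𝒰, ∀ x y : X, CUpsOn Υ U x y ⊆ CUps Υ x y) ∧
    (∀ S : Subgroupoid X,
        (∀ U ∈ 𝒰, ∀ x y : X, CUpsOn Υ U x y ⊆ S.arrows x y) →
        ∀ x y : X, CUps Υ x y ⊆ S.arrows x y) := by
  refine ⟨⟨⟨CUps Υ, CUps_inv_mem hΥ, fun hg _ hk => CUps_comp_mem hΥ hg hk⟩, fun _ _ => rfl⟩,
    fun U _ x y g ⟨lam, _, hg⟩ => ⟨lam, hg⟩, ?_⟩
  rintro S hS x y g ⟨lam, h0, h1, rfl⟩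
  exact (S.eqToHom_comp_comp_eqToHom_mem_iff h0.symm h1 _).2
    (S.pathConnection_mem_of_cover hΥ hopen hcover hS lam)

end
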